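/- Let α ≥ 1 and let σ₁, σ₂, σ₃ be maximal α-gapped α-nonperiodic repeats in a word w such that end(fact(σ₁)) < end(fact(σ₂)) < end(fact(σ₃)) and p(σ₁) < p(σ₂) < p(σ₃). Then p(σ₃) + end(fact(σ₃)) > p(σ₁) + end(fact(σ₁)) + p(σ₁)/(3α). -/

import Mathlib

variable {A : Type*}

/-- `p` is a period of the factor `w[i..j]` of the word `w` (positions are 1-based):
`1 ≤ p ≤ j - i + 1` and `w[k] = w[k+p]` whenever both positions lie in `[i, j]`. -/
def IsPeriodOf (w : ℕ → A) (i j p : ℕ) : Prop :=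
  1 ≤ p ∧ p ≤ j - i + 1 ∧ ∀ k, i ≤ k → k + p ≤ j → w k = w (k + p)

/-- The minimal period of the factor `w[i..j]`. -/
noncomputable def minPer (w : ℕ → A) (i j : ℕ) : ℕ :=
  sInf {p | IsPeriodOf w i j p}

/-- The maximality conditions for a factor `w[i..j]` of the word `w` of length `n`,
with respect to its minimal period: it cannot be extended to the left or to the right
by one letter preserving the minimal period. -/
def MaxCond (n : ℕ) (w : ℕ → A) (i j : ℕ) : Prop :=
  (1 < i → w (i - 1) ≠ w (i + minPer w i j - 1)) ∧
  (j < n → w (j + 1) ≠ w (j - minPer w i j + 1))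

/-- `w[i..j]` is a maximal repetition (run) in the word `w` of length `n`. -/
def IsMaxRepetition (n : ℕ) (w : ℕ → A) (i j : ℕ) : Prop :=
  1 ≤ i ∧ i ≤ j ∧ j ≤ n ∧ 2 * minPer w i j ≤ j - i + 1 ∧ MaxCond n w i j

/-- `w[i..j]` is a maximal subrepetition in the word `w` of length `n`:
its exponent is strictly between 1 and 2 and it satisfies the maximality conditions. -/
def IsMaxSubrepetition (n : ℕ) (w : ℕ → A) (i j : ℕ) : Prop :=
  1 ≤ i ∧ i ≤ j ∧ j ≤ n ∧ minPer w i j < j - i + 1 ∧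
    j - i + 1 < 2 * minPer w i j ∧ MaxCond n w i j

/-- A repeat in the word `w` of length `n`: a pair of equal factors
`w[b1..e1]` (left copy) and `w[b2..e2]` (right copy) with `b1 < b2`. -/
structure WordRepeat (n : ℕ) (w : ℕ → A) where
  b1 : ℕ
  e1 : ℕ
  b2 : ℕ
  e2 : ℕ
  one_le_b1 : 1 ≤ b1
  b1_le_e1 : b1 ≤ e1
  b2_le_e2 : b2 ≤ e2
  e2_le_n : e2 ≤ n
  b1_lt_b2 : b1 < b2
  len_eq : e1 - b1 = e2 - b2
  copies_eq : ∀ k, k ≤ e1 - b1 → w (b1 + k) = w (b2 + k)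

namespace WordRepeat

variable {n : ℕ} {w : ℕ → A}

/-- The period of the repeat. -/
def p (σ : WordRepeat n w) : ℕ := σ.b2 - σ.b1

/-- The length of the copies of the repeat. -/
def c (σ : WordRepeat n w) : ℕ := σ.e1 - σ.b1 + 1

/-- The repeat is maximal: its copies cannot be simultaneously extended to the left
or to the right preserving the period. (`fact σ = w[b1..e2]`.) -/
def Maximal (σ : WordRepeat n w) : Prop :=
  (1 < σ.b1 → w (σ.b1 - 1) ≠ w (σ.b2 - 1)) ∧
  (σ.e2 < n → w (σ.e1 + 1) ≠ w (σ.e2 + 1))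

/-- The repeat is overlapped: its copies are overlapped factors. -/
def Overlapped (σ : WordRepeat n w) : Prop := σ.b2 ≤ σ.e1 + 1

/-- The repeat is gapped: there is a nonempty gap between its copies. -/
def Gapped (σ : WordRepeat n w) : Prop := σ.e1 + 1 < σ.b2

/-- The repeat is `α`-gapped: it is gapped and `p(σ) ≤ α ⬝ c(σ)`. -/
def AlphaGapped (α : ℝ) (σ : WordRepeat n w) : Prop :=
  σ.Gapped ∧ (σ.p : ℝ) ≤ α * (σ.c : ℝ)

/-- `σ` is covered by `σ'`: `fact σ = w[σ.b1..σ.e2]` is contained in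
`fact σ' = w[σ'.b1..σ'.e2]` and `p(σ') < p(σ)`. -/
def CoveredBy (σ σ' : WordRepeat n w) : Prop :=
  σ'.b1 ≤ σ.b1 ∧ σ.e2 ≤ σ'.e2 ∧ σ'.p < σ.p

end WordRepeat

/-- `σ` is the principal repeat of some maximal repetition of `w`
(a reprincipal repeat). -/
def IsPrincipalOfMaxRepetition {n : ℕ} {w : ℕ → A} (σ : WordRepeat n w) : Prop :=
  ∃ i j, IsMaxRepetition n w i j ∧ σ.b1 = i ∧ σ.e1 = j - minPer w i j ∧
    σ.b2 = i + minPer w i j ∧ σ.e2 = j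

/-- `σ` is principal: it is the principal repeat of some maximal repetition or
maximal subrepetition of `w`. -/
def IsPrincipal {n : ℕ} {w : ℕ → A} (σ : WordRepeat n w) : Prop :=
  ∃ i j, (IsMaxRepetition n w i j ∨ IsMaxSubrepetition n w i j) ∧ σ.b1 = i ∧
    σ.e1 = j - minPer w i j ∧ σ.b2 = i + minPer w i j ∧ σ.e2 = j

/-- `σ` is a periodic repeat: its copies are repetitions whose minimal period
is at most `c(σ)/3`. -/
def IsPeriodicRepeat {n : ℕ} {w : ℕ → A} (σ : WordRepeat n w) : Prop :=
  3 * minPer w σ.b1 σ.e1 ≤ σ.c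

/-- The periodic repeat `σ` is represented by the maximal repetition `w[i..j]`:
both copies of `σ` extend (preserving their minimal period) to `w[i..j]`;
equivalently, `w[i..j]` is a maximal repetition whose minimal period equals the
minimal period of the copies of `σ` and which contains both copies of `σ`. -/
def RepresentedBy {n : ℕ} {w : ℕ → A} (σ : WordRepeat n w) (i j : ℕ) : Prop :=
  IsPeriodicRepeat σ ∧ IsMaxRepetition n w i j ∧
  minPer w i j = minPer w σ.b1 σ.e1 ∧ i ≤ σ.b1 ∧ σ.e2 ≤ j

/-- The periodic repeat `σ` is represented by the pair of distinct maximal repetitions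
`w[i1..j1]`, `w[i2..j2]`: the left copy of `σ` extends to `w[i1..j1]`, the right copy
extends to `w[i2..j2]`, the two repetitions being distinct (`σ` is birepresented). -/
def RepresentedByPair {n : ℕ} {w : ℕ → A} (σ : WordRepeat n w)
    (i1 j1 i2 j2 : ℕ) : Prop :=
  IsPeriodicRepeat σ ∧ IsMaxRepetition n w i1 j1 ∧ IsMaxRepetition n w i2 j2 ∧
  minPer w i1 j1 = minPer w σ.b1 σ.e1 ∧ minPer w i2 j2 = minPer w σ.b1 σ.e1 ∧
  i1 ≤ σ.b1 ∧ σ.e1 ≤ j1 ∧ i2 ≤ σ.b2 ∧ σ.e2 ≤ j2 ∧ ¬(i1 = i2 ∧ j1 = j2)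

/-- Every period of a factor bounds its minimal period from above. -/
theorem minPer_le {w : ℕ → A} {i j p : ℕ} (h : IsPeriodOf w i j p) : minPer w i j ≤ p :=
  Nat.sInf_le h

namespace WordRepeat

variable {n : ℕ} {w : ℕ → A}

theorem e2_eq_e1_add_p (σ : WordRepeat n w) : σ.e2 = σ.e1 + σ.p := by
  have := σ.len_eq
  have := σ.b1_le_e1
  have := σ.b2_le_e2
  have := σ.b1_lt_b2
  unfold p
  omega

theorem apply_add_p (σ : WordRepeat n w) {k : ℕ} (hb : σ.b1 ≤ k) (he : k ≤ σ.e1) :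
    w k = w (k + σ.p) := by
  have h := σ.copies_eq (k - σ.b1) (by omega)
  have := σ.b1_lt_b2
  rw [show σ.b1 + (k - σ.b1) = k by omega,
    show σ.b2 + (k - σ.b1) = k + σ.p by unfold p; omega] at h
  exact h

/-- Two positions in the left copies of `σ` and `τ` with the same image in the right copies
carry the same letter. -/
theorem apply_eq_apply (σ τ : WordRepeat n w) {k l : ℕ} (h : k + τ.p = l + σ.p)
    (hkb : τ.b1 ≤ k) (hke : k ≤ τ.e1) (hlb : σ.b1 ≤ l) (hle : l ≤ σ.e1) : w k = w l := by
  rw [τ.apply_add_p hkb hke, h, ← σ.apply_add_p hlb hle]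

/-- If the increase of periods plus the increase of end positions of three repeats is at most a
third of the length of each copy, then the copies of one of the first two repeats have a period
bounded by that increase. -/
theorem minPer_le_or_minPer_le (σ₁ σ₂ σ₃ : WordRepeat n w) {D : ℕ}
    (hD : σ₃.p + σ₃.e2 = σ₁.p + σ₁.e2 + D)
    (h₁ : 3 * D ≤ σ₁.c) (h₂ : 3 * D ≤ σ₂.c) (h₃ : 3 * D ≤ σ₃.c)
    (he₁₂ : σ₁.e2 < σ₂.e2) (he₂₃ : σ₂.e2 < σ₃.e2)
    (hp₁₂ : σ₁.p < σ₂.p) (hp₂₃ : σ₂.p < σ₃.p) :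
    minPer w σ₁.b1 σ₁.e1 ≤ D ∨ minPer w σ₂.b1 σ₂.e1 ≤ D := by
  have hE₁ := σ₁.e2_eq_e1_add_p
  have hE₂ := σ₂.e2_eq_e1_add_p
  have hE₃ := σ₃.e2_eq_e1_add_p
  have := σ₁.b1_le_e1
  have := σ₂.b1_le_e1
  have := σ₃.b1_le_e1
  unfold c at h₁ h₂ h₃
  obtain ⟨d, hd⟩ := Nat.exists_eq_add_of_lt hp₁₂
  obtain ⟨d', hd'⟩ := Nat.exists_eq_add_of_lt hp₂₃
  rcases le_or_gt (σ₁.b1 + σ₁.p) (σ₂.b1 + σ₂.p) with hb | hb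
  · right
    suffices H : IsPeriodOf w σ₂.b1 σ₂.e1 (d + 1) from (minPer_le H).trans (by omega)
    refine ⟨by omega, by omega, fun k => ?_⟩
    induction k using Nat.strong_induction_on with
    | _ k ih =>
      intro hk hk'
      rcases le_or_gt (k + (d + 1)) σ₁.e1 with hle | hlt
      · exact σ₁.apply_eq_apply σ₂ (by omega) hk (by omega) (by omega) hle
      · have hprev := ih (k - (d' + 1)) (by omega) (by omega) (by omega)
        rw [← σ₂.apply_eq_apply σ₃ (k := k - (d' + 1)) (l := k)
            (by omega) (by omega) (by omega) (by omega) (by omega), hprev]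
        exact σ₂.apply_eq_apply σ₃ (by omega) (by omega) (by omega) (by omega) (by omega)
  · left
    suffices H : IsPeriodOf w σ₁.b1 σ₁.e1 (d + 1) from (minPer_le H).trans (by omega)
    refine ⟨by omega, by omega, fun k hk hk' => ?_⟩
    exact σ₁.apply_eq_apply σ₂ (by omega) (by omega) (by omega) (by omega) hk'

end WordRepeat

/-- For three maximal `α`-gapped `α`-nonperiodic repeats `σ1, σ2, σ3` with increasing
ending positions and increasing periods,
`p(σ3) + end(fact σ3) > p(σ1) + end(fact σ1) + p(σ1)/(3α)`. -/
theorem pe_gap_of_three_nonperiodic {A : Type*} (α : ℝ) (hα : 1 ≤ α)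
    (n : ℕ) (w : ℕ → A) (σ1 σ2 σ3 : WordRepeat n w)
    (h1max : σ1.Maximal) (h1gap : σ1.AlphaGapped α)
    (h1non : (σ1.p : ℝ) / (3 * α) < (minPer w σ1.b1 σ1.e1 : ℝ))
    (h2max : σ2.Maximal) (h2gap : σ2.AlphaGapped α)
    (h2non : (σ2.p : ℝ) / (3 * α) < (minPer w σ2.b1 σ2.e1 : ℝ))
    (h3max : σ3.Maximal) (h3gap : σ3.AlphaGapped α)
    (h3non : (σ3.p : ℝ) / (3 * α) < (minPer w σ3.b1 σ3.e1 : ℝ))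
    (hend12 : σ1.e2 < σ2.e2) (hend23 : σ2.e2 < σ3.e2)
    (hp12 : σ1.p < σ2.p) (hp23 : σ2.p < σ3.p) :
    (σ1.p : ℝ) + (σ1.e2 : ℝ) + (σ1.p : ℝ) / (3 * α) <
      (σ3.p : ℝ) + (σ3.e2 : ℝ) := by
  by_contra! hcon
  have hα₀ : 0 < α := by linarith
  obtain ⟨D, hD⟩ : ∃ D, σ3.p + σ3.e2 = σ1.p + σ1.e2 + D :=
    Nat.exists_eq_add_of_le (by omega)
  have hDR : (σ3.p : ℝ) + σ3.e2 = σ1.p + σ1.e2 + D := by exact_mod_cast hD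
  have hDδ : (D : ℝ) ≤ σ1.p / (3 * α) := by linarith
  have hDp : D * (3 * α) ≤ (σ1.p : ℝ) := (le_div_iff₀ (by positivity)).1 hDδ
  have copy_length (σ : WordRepeat n w) (hσ : σ.AlphaGapped α) (hp : σ1.p ≤ σ.p) :
      3 * D ≤ σ.c := by
    have hpR : (σ1.p : ℝ) ≤ σ.p := by exact_mod_cast hp
    have : α * (3 * D : ℝ) ≤ α * σ.c := by linarith [hσ.2]
    exact_mod_cast le_of_mul_le_mul_left this hα₀
  have hδ : (σ1.p : ℝ) / (3 * α) ≤ σ2.p / (3 * α) := by gcongr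
  have hD₁ : D < minPer w σ1.b1 σ1.e1 := by exact_mod_cast hDδ.trans_lt h1non
  have hD₂ : D < minPer w σ2.b1 σ2.e1 := by exact_mod_cast (hDδ.trans hδ).trans_lt h2non
  rcases σ1.minPer_le_or_minPer_le σ2 σ3 hD (copy_length σ1 h1gap le_rfl)
    (copy_length σ2 h2gap hp12.le) (copy_length σ3 h3gap (hp12.trans hp23).le)
    hend12 hend23 hp12 hp23 with h | h <;> omega
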